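/- In H(gl(1,1)), let w := −x + 2uv. Then wx = xw, wy = yw, wu = −uw, wv = −vw and wt = tw; consequently the element wt lies in the center of H(gl(1,1)). -/

import Mathlib

open FreeAlgebra

noncomputable section

/-- The defining relations of the bosonization `H(gl(1,1))`: generators
`x = ι 0`, `y = ι 1`, `u = ι 2`, `v = ι 3`, `t = ι 4`. -/
inductive Hrel : FreeAlgebra ℂ (Fin 5) → FreeAlgebra ℂ (Fin 5) → Prop
  | xy : Hrel (ι ℂ 0 * ι ℂ 1) (ι ℂ 1 * ι ℂ 0)
  | xu : Hrel (ι ℂ 0 * ι ℂ 2) (ι ℂ 2 * ι ℂ 0)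
  | xv : Hrel (ι ℂ 0 * ι ℂ 3) (ι ℂ 3 * ι ℂ 0)
  | yu : Hrel (ι ℂ 1 * ι ℂ 2 - ι ℂ 2 * ι ℂ 1) (ι ℂ 2)
  | yv : Hrel (ι ℂ 1 * ι ℂ 3 - ι ℂ 3 * ι ℂ 1) (-ι ℂ 3)
  | uu : Hrel (ι ℂ 2 * ι ℂ 2) 0
  | vv : Hrel (ι ℂ 3 * ι ℂ 3) 0
  | uv : Hrel (ι ℂ 2 * ι ℂ 3 + ι ℂ 3 * ι ℂ 2) (ι ℂ 0)
  | tt : Hrel (ι ℂ 4 * ι ℂ 4) 1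
  | tx : Hrel (ι ℂ 4 * ι ℂ 0) (ι ℂ 0 * ι ℂ 4)
  | ty : Hrel (ι ℂ 4 * ι ℂ 1) (ι ℂ 1 * ι ℂ 4)
  | tu : Hrel (ι ℂ 4 * ι ℂ 2) (-(ι ℂ 2 * ι ℂ 4))
  | tv : Hrel (ι ℂ 4 * ι ℂ 3) (-(ι ℂ 3 * ι ℂ 4))

/-- The bosonization `H(gl(1,1))`, i.e. the free algebra modulo the two-sided
ideal generated by the relations. -/
abbrev Hgl : Type := RingQuot Hrel

/-- The image of the generator `x` in `H(gl(1,1))`. -/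
def hx : Hgl := RingQuot.mkAlgHom ℂ Hrel (ι ℂ 0)
/-- The image of the generator `y` in `H(gl(1,1))`. -/
def hy : Hgl := RingQuot.mkAlgHom ℂ Hrel (ι ℂ 1)
/-- The image of the generator `u` in `H(gl(1,1))`. -/
def hu : Hgl := RingQuot.mkAlgHom ℂ Hrel (ι ℂ 2)
/-- The image of the generator `v` in `H(gl(1,1))`. -/
def hv : Hgl := RingQuot.mkAlgHom ℂ Hrel (ι ℂ 3)
/-- The image of the generator `t` in `H(gl(1,1))`. -/
def ht : Hgl := RingQuot.mkAlgHom ℂ Hrel (ι ℂ 4)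

/-- An element of `H(gl(1,1))` commuting with each generator is central. -/
theorem mem_center_of_commute_generators {z : Hgl} (zx : Commute z hx) (zy : Commute z hy)
    (zu : Commute z hu) (zv : Commute z hv) (zt : Commute z ht) :
    z ∈ Subring.center Hgl := by
  rw [Subring.mem_center_iff]
  intro g
  obtain ⟨a, rfl⟩ := RingQuot.mkAlgHom_surjective ℂ Hrel g
  suffices h : Commute z (RingQuot.mkAlgHom ℂ Hrel a) from h.symm.eq
  induction a using FreeAlgebra.induction with
  | grade0 r =>
    rw [AlgHom.commutes]
    exact Algebra.commute_algebraMap_right r z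
  | grade1 i => fin_cases i <;> assumption
  | mul a b ha hb => rw [map_mul]; exact ha.mul_right hb
  | add a b ha hb => rw [map_add]; exact ha.add_right hb

theorem hx_mul_hy : hx * hy = hy * hx := by
  simpa [hx, hy] using RingQuot.mkAlgHom_rel ℂ Hrel.xy

theorem hx_mul_hu : hx * hu = hu * hx := by
  simpa [hx, hu] using RingQuot.mkAlgHom_rel ℂ Hrel.xu

theorem hx_mul_hv : hx * hv = hv * hx := by
  simpa [hx, hv] using RingQuot.mkAlgHom_rel ℂ Hrel.xv

theorem hy_mul_hu_sub : hy * hu - hu * hy = hu := by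
  simpa only [hy, hu, map_sub, map_mul] using RingQuot.mkAlgHom_rel ℂ Hrel.yu

theorem hy_mul_hv_sub : hy * hv - hv * hy = -hv := by
  simpa only [hy, hv, map_sub, map_mul, map_neg] using RingQuot.mkAlgHom_rel ℂ Hrel.yv

theorem hu_mul_hu : hu * hu = 0 := by
  simpa only [hu, map_zero, map_mul] using RingQuot.mkAlgHom_rel ℂ Hrel.uu

theorem hv_mul_hv : hv * hv = 0 := by
  simpa only [hv, map_zero, map_mul] using RingQuot.mkAlgHom_rel ℂ Hrel.vv

theorem hu_mul_hv_add : hu * hv + hv * hu = hx := by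
  simpa only [hu, hv, hx, map_add, map_mul] using RingQuot.mkAlgHom_rel ℂ Hrel.uv

theorem ht_mul_hx : ht * hx = hx * ht := by
  simpa only [ht, hx, map_mul] using RingQuot.mkAlgHom_rel ℂ Hrel.tx

theorem ht_mul_hy : ht * hy = hy * ht := by
  simpa only [ht, hy, map_mul] using RingQuot.mkAlgHom_rel ℂ Hrel.ty

theorem ht_mul_hu : ht * hu = -(hu * ht) := by
  simpa only [ht, hu, map_neg, map_mul] using RingQuot.mkAlgHom_rel ℂ Hrel.tu

theorem ht_mul_hv : ht * hv = -(hv * ht) := by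
  simpa only [ht, hv, map_neg, map_mul] using RingQuot.mkAlgHom_rel ℂ Hrel.tv

theorem commute_hu_mul_hv_hx : Commute (hu * hv) hx :=
  (Commute.mul_right hx_mul_hu hx_mul_hv).symm

/-- If `u` and `v` are eigenvectors of the commutator with `y` for opposite eigenvalues `1`
and `-1`, then `y` commutes with `u * v`. -/
theorem commute_mul_of_sub_eq {R : Type*} [Ring R] {y u v : R}
    (hu : y * u - u * y = u) (hv : y * v - v * y = -v) : Commute (u * v) y := by
  have h : y * (u * v) - u * v * y = (y * u - u * y) * v + u * (y * v - v * y) := by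
    noncomm_ring
  rw [hu, hv, mul_neg, add_neg_cancel, sub_eq_zero] at h
  exact h.symm

theorem commute_hu_mul_hv_hy : Commute (hu * hv) hy :=
  commute_mul_of_sub_eq hy_mul_hu_sub hy_mul_hv_sub

/-- The product of two elements that both anticommute with `a` commutes with `a`. -/
theorem commute_mul_of_anticommute {R : Type*} [Ring R] {a b c : R}
    (hb : b * a = -(a * b)) (hc : c * a = -(a * c)) : Commute (b * c) a := by
  rw [commute_iff_eq, mul_assoc, hc, mul_neg, ← mul_assoc, hb, neg_mul, neg_neg, mul_assoc]

theorem commute_hu_mul_hv_ht : Commute (hu * hv) ht :=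
  commute_mul_of_anticommute (neg_eq_iff_eq_neg.mp ht_mul_hu.symm)
    (neg_eq_iff_eq_neg.mp ht_mul_hv.symm)

/-- The element `-x + 2uv` commutes with `a` as soon as `x` and `uv` do. -/
theorem commute_neg_hx_add {a : Hgl} (h : Commute hx a) (h' : Commute (hu * hv) a) :
    Commute (-hx + 2 * hu * hv) a := by
  rw [mul_assoc]
  exact h.neg_left.add_left ((Commute.ofNat_left 2 a).mul_left h')

theorem neg_hx_add_eq : -hx + 2 * hu * hv = hu * hv - hv * hu := by
  rw [← hu_mul_hv_add]
  noncomm_ring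

theorem neg_hx_add_mul_hu : (-hx + 2 * hu * hv) * hu = -(hu * (-hx + 2 * hu * hv)) := by
  rw [neg_hx_add_eq, sub_mul, mul_sub, mul_assoc hv, ← mul_assoc hu hu, hu_mul_hu]
  simp [mul_assoc]

theorem neg_hx_add_mul_hv : (-hx + 2 * hu * hv) * hv = -(hv * (-hx + 2 * hu * hv)) := by
  rw [neg_hx_add_eq, sub_mul, mul_sub, mul_assoc hu, ← mul_assoc hv hv, hv_mul_hv]
  simp [mul_assoc]

/-- For `w = -x + 2uv` in `H(gl(1,1))`: `w` commutes with `x`, `y`, `t`,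
anticommutes with `u`, `v`, and `wt` is central. -/
theorem stmt_3 :
    let w : Hgl := -hx + 2 * hu * hv
    w * hx = hx * w ∧ w * hy = hy * w ∧ w * hu = -(hu * w) ∧
      w * hv = -(hv * w) ∧ w * ht = ht * w ∧
      w * ht ∈ Subring.center Hgl := by
  intro w
  have wx : Commute w hx := commute_neg_hx_add (Commute.refl hx) commute_hu_mul_hv_hx
  have wy : Commute w hy := commute_neg_hx_add hx_mul_hy commute_hu_mul_hv_hy
  have wt : Commute w ht := commute_neg_hx_add ht_mul_hx.symm commute_hu_mul_hv_ht
  refine ⟨wx, wy, neg_hx_add_mul_hu, neg_hx_add_mul_hv, wt, ?_⟩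
  exact mem_center_of_commute_generators (wx.mul_left ht_mul_hx) (wy.mul_left ht_mul_hy)
    (commute_mul_of_anticommute neg_hx_add_mul_hu ht_mul_hu)
    (commute_mul_of_anticommute neg_hx_add_mul_hv ht_mul_hv)
    (wt.mul_left (Commute.refl ht))
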